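/- The commutant {S,T}′ = {X ∈ M₁₀(ℂ) : XS = SX and XT = TX} is a complex linear subspace of the 10×10 complex matrices of dimension exactly 4. -/

import Mathlib

open Matrix Complex

noncomputable section

/-- d = 1 + √3 -/
def dd : ℂ := 1 + Real.sqrt 3

/-- L = 2 + d² = 6 + 2√3 -/
def LL : ℂ := 6 + 2 * Real.sqrt 3

/-- The S-matrix of the modular data of the quantum double of the even E6 system. -/
def S : Matrix (Fin 10) (Fin 10) ℂ := LL⁻¹ •
  !![1,    1,    1+dd, 1+dd, 2+dd,  dd,   dd,    dd,          dd,          dd;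
     1,    1,    1+dd, 1+dd, -2-dd, dd,   dd,    -dd,         -dd,         -dd;
     1+dd, 1+dd, 1,    1,    2+dd,  -dd,  -dd,   -dd,         -dd,         -dd;
     1+dd, 1+dd, 1,    1,    -2-dd, -dd,  -dd,   dd,          dd,          dd;
     2+dd, -2-dd,2+dd, -2-dd,0,     0,    0,     0,           0,           0;
     dd,   dd,   -dd,  -dd,  0,     dd,   dd,    -dd,         -dd,         2*dd;
     dd,   dd,   -dd,  -dd,  0,     dd,   dd,    -dd,         -dd,         -2*dd;
     dd,   -dd,  -dd,  dd,   0,     -dd,  dd,    -(2+dd)*I,   (2+dd)*I,    0;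
     dd,   -dd,  -dd,  dd,   0,     -dd,  dd,    (2+dd)*I,    -(2+dd)*I,   0;
     dd,   -dd,  -dd,  dd,   0,     2*dd, -2*dd, 0,           0,           0]

/-- The T-matrix: diag(1,−1,1,−1,1,e^{πi/3},e^{4πi/3},e^{5πi/6},e^{5πi/6},−i). -/
def T : Matrix (Fin 10) (Fin 10) ℂ := Matrix.diagonal
  ![1, -1, 1, -1, 1,
    Complex.exp (Real.pi * I / 3), Complex.exp (4 * Real.pi * I / 3),
    Complex.exp (5 * Real.pi * I / 6), Complex.exp (5 * Real.pi * I / 6), -I]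

/-- The commutant {S,T}′ as a complex subspace of the 10×10 matrices. -/
def Comm : Submodule ℂ (Matrix (Fin 10) (Fin 10) ℂ) where
  carrier := {X | X * S = S * X ∧ X * T = T * X}
  add_mem' := by
    rintro a b ⟨ha1, ha2⟩ ⟨hb1, hb2⟩
    constructor <;> simp [add_mul, mul_add, ha1, ha2, hb1, hb2]
  zero_mem' := by simp
  smul_mem' := by
    rintro c a ⟨ha1, ha2⟩
    constructor <;> simp [Matrix.smul_mul, Matrix.mul_smul, ha1, ha2]

/-- The matrix `S` before normalisation by `LL⁻¹`. -/
def unnormalizedS : Matrix (Fin 10) (Fin 10) ℂ :=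
  !![1,    1,    1+dd, 1+dd, 2+dd,  dd,   dd,    dd,          dd,          dd;
     1,    1,    1+dd, 1+dd, -2-dd, dd,   dd,    -dd,         -dd,         -dd;
     1+dd, 1+dd, 1,    1,    2+dd,  -dd,  -dd,   -dd,         -dd,         -dd;
     1+dd, 1+dd, 1,    1,    -2-dd, -dd,  -dd,   dd,          dd,          dd;
     2+dd, -2-dd,2+dd, -2-dd,0,     0,    0,     0,           0,           0;
     dd,   dd,   -dd,  -dd,  0,     dd,   dd,    -dd,         -dd,         2*dd;
     dd,   dd,   -dd,  -dd,  0,     dd,   dd,    -dd,         -dd,         -2*dd;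
     dd,   -dd,  -dd,  dd,   0,     -dd,  dd,    -(2+dd)*I,   (2+dd)*I,    0;
     dd,   -dd,  -dd,  dd,   0,     -dd,  dd,    (2+dd)*I,    -(2+dd)*I,   0;
     dd,   -dd,  -dd,  dd,   0,     2*dd, -2*dd, 0,           0,           0]

/-- The diagonal entries of `T` as exponents of `exp (2πi/12)`. -/
def exponentT : Fin 10 → ℕ := ![0, 6, 0, 6, 0, 2, 8, 5, 5, 9]

lemma S_eq : S = LL⁻¹ • unnormalizedS := rfl

lemma dd_ne_zero : dd ≠ 0 := by
  have h : (1 + Real.sqrt 3 : ℝ) ≠ 0 := by positivity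
  unfold dd
  exact_mod_cast h

lemma two_add_dd_ne_zero : 2 + dd ≠ 0 := by
  have h : (2 + (1 + Real.sqrt 3) : ℝ) ≠ 0 := by positivity
  unfold dd
  exact_mod_cast h

lemma LL_ne_zero : LL ≠ 0 := by
  have h : (6 + 2 * Real.sqrt 3 : ℝ) ≠ 0 := by positivity
  unfold LL
  exact_mod_cast h

lemma commute_S_iff (X : Matrix (Fin 10) (Fin 10) ℂ) :
    X * S = S * X ↔ X * unnormalizedS = unnormalizedS * X := by
  rw [S_eq, Matrix.mul_smul, Matrix.smul_mul]
  exact (smul_right_injective _ (inv_ne_zero LL_ne_zero)).eq_iff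

lemma T_eq : T = Matrix.diagonal fun i ↦ exp (2 * Real.pi * I / (12 : ℕ)) ^ exponentT i := by
  have h6 : exp (2 * Real.pi * I / (12 : ℕ)) ^ 6 = -1 := by
    rw [← Complex.exp_nat_mul, ← Complex.exp_pi_mul_I]
    congr 1
    push_cast
    ring
  have h3 : exp (2 * Real.pi * I / (12 : ℕ)) ^ 3 = I := by
    refine Eq.trans ?_ Complex.exp_pi_div_two_mul_I
    rw [← Complex.exp_nat_mul]
    congr 1
    push_cast
    ring
  unfold T
  congr 1
  funext i
  fin_cases i <;>
    simp only [exponentT, Fin.reduceFinMk, Fin.zero_eta, Fin.mk_one, Matrix.cons_val] <;>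
    first
    | exact (pow_zero _).symm
    | exact h6.symm
    | rw [show 9 = 6 + 3 from rfl, pow_add, h6, h3, neg_one_mul]
    | (rw [← Complex.exp_nat_mul]
       congr 1
       push_cast
       ring)

lemma commute_T_iff (X : Matrix (Fin 10) (Fin 10) ℂ) :
    X * T = T * X ↔ ∀ i j, exponentT i ≠ exponentT j → X i j = 0 := by
  have hlt (i) : exponentT i < 12 := by fin_cases i <;> simp [exponentT]
  have hinj (i j) : exp (2 * Real.pi * I / (12 : ℕ)) ^ exponentT i =
      exp (2 * Real.pi * I / (12 : ℕ)) ^ exponentT j ↔ exponentT i = exponentT j :=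
    ⟨(Complex.isPrimitiveRoot_exp 12 (by norm_num)).pow_inj (hlt i) (hlt j), fun h ↦ by rw [h]⟩
  rw [T_eq, ← Matrix.ext_iff]
  refine forall₂_congr fun i j ↦ ?_
  rw [Matrix.mul_diagonal, Matrix.diagonal_mul, mul_comm, mul_eq_mul_right_iff, hinj, ne_comm,
    ← or_iff_not_imp_left]

/-- The general element of the commutant in terms of its diagonal entries at `4`, `3`, `8`, `9`. -/
def commMatrix (v : Fin 4 → ℂ) : Matrix (Fin 10) (Fin 10) ℂ :=
  let a := v 0
  let b := v 1
  let c := v 2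
  let f := v 3
  !![a-b+f,   0,   a-b,     0,   a-2*b+f, 0, 0, 0,   0,   0;
     0,       b,   0,       b-f, 0,       0, 0, 0,   0,   0;
     a-b,     0,   a-b+f,   0,   a-2*b+f, 0, 0, 0,   0,   0;
     0,       b-f, 0,       b,   0,       0, 0, 0,   0,   0;
     a-2*b+f, 0,   a-2*b+f, 0,   a,       0, 0, 0,   0,   0;
     0,       0,   0,       0,   0,       f, 0, 0,   0,   0;
     0,       0,   0,       0,   0,       0, f, 0,   0,   0;
     0,       0,   0,       0,   0,       0, 0, c,   f-c, 0;
     0,       0,   0,       0,   0,       0, 0, f-c, c,   0;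
     0,       0,   0,       0,   0,       0, 0, 0,   0,   f]

set_option maxHeartbeats 4000000 in
lemma commMatrix_mem (v : Fin 4 → ℂ) : commMatrix v ∈ Comm := by
  refine ⟨(commute_S_iff _).2 ?_, (commute_T_iff _).2 ?_⟩
  · ext i j
    fin_cases i <;> fin_cases j <;>
      simp [commMatrix, unnormalizedS, Matrix.mul_apply, Fin.sum_univ_succ] <;> ring
  · intro i j
    fin_cases i <;> fin_cases j <;> simp [commMatrix, exponentT]

set_option maxHeartbeats 4000000 in
lemma eq_commMatrix {X : Matrix (Fin 10) (Fin 10) ℂ} (hX : X ∈ Comm) :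
    X = commMatrix ![X 4 4, X 3 3, X 8 8, X 9 9] := by
  obtain ⟨hS, hT⟩ := hX
  rw [commute_S_iff] at hS
  rw [commute_T_iff] at hT
  have entry (i j) : ∑ k, X i k * unnormalizedS k j = ∑ k, unnormalizedS i k * X k j := by
    simpa only [Matrix.mul_apply] using congrFun₂ hS i j
  have e95 := entry 9 5
  have e96 := entry 9 6
  have e90 := entry 9 0
  have e09 := entry 0 9
  have e92 := entry 9 2
  have e94 := entry 9 4
  have e49 := entry 4 9
  have e91 := entry 9 1
  have e93 := entry 9 3
  have e19 := entry 1 9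
  have e75 := entry 7 5
  have e85 := entry 8 5
  have e57 := entry 5 7
  have e04 := entry 0 4
  have e40 := entry 4 0
  have e01 := entry 0 1
  simp [unnormalizedS, Fin.sum_univ_succ]
    at e95 e96 e90 e09 e92 e94 e49 e91 e93 e19 e75 e85 e57 e04 e40 e01
  simp (disch := decide) only [hT, mul_zero, zero_mul, add_zero, zero_add, neg_zero]
    at e95 e96 e90 e09 e92 e94 e49 e91 e93 e19 e75 e85 e57 e04 e40 e01
  have h55 : X 5 5 = X 9 9 := mul_left_cancel₀ dd_ne_zero (by linear_combination -e95 / 2)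
  have h66 : X 6 6 = X 9 9 := mul_left_cancel₀ dd_ne_zero (by linear_combination e96 / 2)
  have h20 : X 2 0 = X 0 0 - X 9 9 := mul_left_cancel₀ dd_ne_zero (by linear_combination e90)
  have h02 : X 0 2 = X 0 0 - X 9 9 := mul_left_cancel₀ dd_ne_zero (by linear_combination -e09)
  have h22 : X 2 2 = X 0 0 := mul_left_cancel₀ dd_ne_zero (by linear_combination e92 - e09)
  have h24 : X 2 4 = X 0 4 := mul_left_cancel₀ dd_ne_zero (by linear_combination e94)
  have h42 : X 4 2 = X 4 0 := mul_left_cancel₀ dd_ne_zero (by linear_combination -e49)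
  have h11 : X 1 1 = X 3 3 := mul_left_cancel₀ dd_ne_zero (by linear_combination e93 - e19)
  have h13 : X 1 3 = X 3 3 - X 9 9 := mul_left_cancel₀ dd_ne_zero (by linear_combination e93)
  have h31 : X 3 1 = X 3 3 - X 9 9 := mul_left_cancel₀ dd_ne_zero (by
    linear_combination e93 - e19 - e91)
  have h77 : X 7 7 = X 8 8 := mul_left_cancel₀ dd_ne_zero (by linear_combination e57 + e85)
  have h87 : X 8 7 = X 9 9 - X 8 8 := mul_left_cancel₀ dd_ne_zero (by
    linear_combination -e85 - e95 / 2)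
  have h78 : X 7 8 = X 9 9 - X 8 8 := mul_left_cancel₀ dd_ne_zero (by
    linear_combination -e75 - e95 / 2 - e57 - e85)
  have h04 : X 0 4 = X 0 0 + X 0 2 - X 4 4 := mul_left_cancel₀ two_add_dd_ne_zero (by
    linear_combination -e04 - (1 + dd) * h24)
  have h40 : X 4 0 = X 0 0 + X 2 0 - X 4 4 := mul_left_cancel₀ two_add_dd_ne_zero (by
    linear_combination e40 - (1 + dd) * h42)
  have h00 : X 0 0 = X 4 4 - X 3 3 + X 9 9 := mul_left_cancel₀ two_add_dd_ne_zero (by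
    linear_combination -e01 + (1 + dd) * h02 - (2 + dd) * (h04 + h02) - h11 - (1 + dd) * h31)
  ext i j
  by_cases hij : exponentT i = exponentT j
  · fin_cases i <;> fin_cases j <;> first
      | exact absurd hij (by decide)
      | (simp [commMatrix]; done)
      | (simp [commMatrix]; grind)
  · rw [hT i j hij, (commute_T_iff _).1 (commMatrix_mem _).2 i j hij]

/-- Elements of the commutant are determined by four of their diagonal entries. -/
def commEquiv : Comm ≃ₗ[ℂ] (Fin 4 → ℂ) where
  toFun X := ![X.1 4 4, X.1 3 3, X.1 8 8, X.1 9 9]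
  map_add' X Y := by simp
  map_smul' c X := by simp
  invFun v := ⟨commMatrix v, commMatrix_mem v⟩
  left_inv X := Subtype.ext (eq_commMatrix X.2).symm
  right_inv v := by
    ext i
    fin_cases i <;> simp [commMatrix]

/-- The commutant {S,T}′ has complex dimension exactly 4. -/
theorem commutant_dim_four : Module.finrank ℂ Comm = 4 := by
  rw [commEquiv.finrank_eq, Module.finrank_fin_fun]
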